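/- Let Q ∈ ℝ^{6×9}, u ∈ ℝ⁶, λ* ∈ ℝ⁶, and let R ∈ ℝ^{3×3} satisfy vec(R) = Qᵀλ*. Assume P = [[I₃, R],[Rᵀ, I₃]] is positive semidefinite. Suppose s_L, s_F, c_L, c_F ∈ ℝ³ satisfy the feasibility constraint Q(s_F ⊗ s_L + c_F ⊗ c_L) = u together with s_L + R s_F = 0, s_F + Rᵀ s_L = 0, c_L + R c_F = 0, and c_F + Rᵀ c_L = 0. Then m* = [s_L; s_F; c_L; c_F] globally minimizes (1/2)‖m‖² over all m = [s_L'; s_F'; c_L'; c_F'] ∈ ℝ¹² with Q(s_F' ⊗ s_L' + c_F' ⊗ c_L') = u; in particular the optimal follower amplitudes satisfy [s_F, c_F] = −Rᵀ[s_L, c_L]. -/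

import Mathlib

open Matrix

theorem aux_dual (Q : Matrix (Fin 6) (Fin 3 × Fin 3) ℝ)
    (u lam : Fin 6 → ℝ) (R : Matrix (Fin 3) (Fin 3) ℝ)
    (hR : ∀ p : Fin 3 × Fin 3, R p.2 p.1 = Qᵀ.mulVec lam p)
    (a b c d : Fin 3 → ℝ)
    (hf : Q.mulVec (fun p => b p.1 * a p.2 + d p.1 * c p.2) = u) :
    a ⬝ᵥ R.mulVec b + c ⬝ᵥ R.mulVec d = lam ⬝ᵥ u := by
  rw [← hf, Matrix.dotProduct_mulVec lam, ← Matrix.mulVec_transpose]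
  have : Qᵀ.mulVec lam = fun p => R p.2 p.1 := by
    funext p; exact (hR p).symm
  rw [this]
  simp only [dotProduct, Matrix.mulVec, Fintype.sum_prod_type, Fin.sum_univ_three]
  ring

theorem aux_psd (R : Matrix (Fin 3) (Fin 3) ℝ)
    (hP : (Matrix.fromBlocks 1 R Rᵀ 1 :
        Matrix (Fin 3 ⊕ Fin 3) (Fin 3 ⊕ Fin 3) ℝ).PosSemidef)
    (a b : Fin 3 → ℝ) :
    0 ≤ a ⬝ᵥ a + b ⬝ᵥ b + 2 * (a ⬝ᵥ R.mulVec b) := by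
  have h := hP.dotProduct_mulVec_nonneg (Sum.elim a b)
  rw [Matrix.fromBlocks_mulVec] at h
  simp [dotProduct, Matrix.mulVec, Fin.sum_univ_three, Matrix.one_apply] at h
  simp only [dotProduct, Matrix.mulVec, Fin.sum_univ_three]
  linarith

theorem aux_eq (R : Matrix (Fin 3) (Fin 3) ℝ) (a b : Fin 3 → ℝ)
    (h1 : a + R.mulVec b = 0) (h2 : b + Rᵀ.mulVec a = 0) :
    a ⬝ᵥ a + b ⬝ᵥ b + 2 * (a ⬝ᵥ R.mulVec b) = 0 := by
  have e1 : a ⬝ᵥ (a + R.mulVec b) = 0 := by rw [h1]; simp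
  have e2 : b ⬝ᵥ (b + Rᵀ.mulVec a) = 0 := by rw [h2]; simp
  rw [dotProduct_add] at e1 e2
  have e3 : b ⬝ᵥ Rᵀ.mulVec a = a ⬝ᵥ R.mulVec b := by
    rw [Matrix.mulVec_transpose, dotProduct_comm, ← Matrix.dotProduct_mulVec]
  linarith

/-- Two-agent power-optimal dipole allocation (Theorem 1): if `vec(R) = Qᵀλ*`,
`P = [[I₃, R],[Rᵀ, I₃]] ⪰ 0`, and `(s_L, s_F, c_L, c_F)` satisfies the feasibility
constraint `Q(s_F ⊗ s_L + c_F ⊗ c_L) = u` together with the stationarity conditions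
`s_L + R s_F = 0`, `s_F + Rᵀs_L = 0`, `c_L + R c_F = 0`, `c_F + Rᵀc_L = 0`, then
`m* = [s_L; s_F; c_L; c_F]` globally minimizes `½‖m‖²` over all feasible dipoles;
in particular `[s_F, c_F] = −Rᵀ[s_L, c_L]`. -/
theorem two_agent_power_optimal (Q : Matrix (Fin 6) (Fin 3 × Fin 3) ℝ)
    (u lam : Fin 6 → ℝ) (R : Matrix (Fin 3) (Fin 3) ℝ)
    (hR : ∀ p : Fin 3 × Fin 3, R p.2 p.1 = Qᵀ.mulVec lam p)
    (hP : (Matrix.fromBlocks 1 R Rᵀ 1 :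
        Matrix (Fin 3 ⊕ Fin 3) (Fin 3 ⊕ Fin 3) ℝ).PosSemidef)
    (sL sF cL cF : Fin 3 → ℝ)
    (hfeas : Q.mulVec (fun p => sF p.1 * sL p.2 + cF p.1 * cL p.2) = u)
    (h1 : sL + R.mulVec sF = 0) (h2 : sF + Rᵀ.mulVec sL = 0)
    (h3 : cL + R.mulVec cF = 0) (h4 : cF + Rᵀ.mulVec cL = 0) :
    (∀ sL' sF' cL' cF' : Fin 3 → ℝ,
        Q.mulVec (fun p => sF' p.1 * sL' p.2 + cF' p.1 * cL' p.2) = u →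
        (1 / 2) * (sL ⬝ᵥ sL + sF ⬝ᵥ sF + cL ⬝ᵥ cL + cF ⬝ᵥ cF) ≤
          (1 / 2) * (sL' ⬝ᵥ sL' + sF' ⬝ᵥ sF' + cL' ⬝ᵥ cL' + cF' ⬝ᵥ cF')) ∧
      sF = -(Rᵀ.mulVec sL) ∧ cF = -(Rᵀ.mulVec cL) := by
  refine ⟨?_, eq_neg_of_add_eq_zero_left h2, eq_neg_of_add_eq_zero_left h4⟩
  intro a b c d hf
  have k1 := aux_dual Q u lam R hR sL sF cL cF hfeas
  have k2 := aux_dual Q u lam R hR a b c d hf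
  have p1 := aux_psd R hP a b
  have p2 := aux_psd R hP c d
  have q1 := aux_eq R sL sF h1 h2
  have q2 := aux_eq R cL cF h3 h4
  linarith
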